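/- arXiv:1205.2948 — 4 statements merged into one kernel-verified Lean document; each statement's English description precedes it below -/
import Mathlib

section
/- Suppose {e_n} are i.i.d. random variables whose common distribution has a continuous, bounded and strictly positive density on ℝ, and let {y_n} be the unique strictly stationary solution of the TMA(q) model. Then there exists a constant ρ ∈ (0,1) and a constant C > 0 such that for all u, v ∈ ℝ and all integers k ≥ 1, |P(y_0 ≤ u, y_k ≤ v) − P(y_0 ≤ u)·P(y_k ≤ v)| ≤ C·ρ^k. -/
open MeasureTheory ProbabilityTheory Filter Finset

/-- `X n` is a measurable function of the noise window `e (n - q), …, e n`. -/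
def WindowMeasurable {Ω : Type*} (e : ℤ → Ω → ℝ) (q : ℕ) (X : ℤ → Ω → ℝ) : Prop :=
  ∀ (m : MeasurableSpace Ω) (n : ℤ),
    (∀ i, n - q ≤ i → i ≤ n → Measurable[m] (e i)) → Measurable[m] (X n)

namespace WindowMeasurable

variable {Ω : Type*} {e : ℤ → Ω → ℝ} {q : ℕ} {X Y : ℤ → Ω → ℝ}

theorem movingAverage {c : ℝ} {θ : ℕ → ℝ}
    (hX : ∀ n ω, X n ω = c + e n ω + ∑ i ∈ Finset.Icc 1 q, θ i * e (n - i) ω) :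
    WindowMeasurable e q X := by
  intro m n h
  rw [funext (hX n)]
  refine (measurable_const.add (h n (by lia) le_rfl)).add
    (Finset.measurable_fun_sum _ fun i hi => (h _ ?_ ?_).const_mul _)
  · have := (Finset.mem_Icc.1 hi).2
    lia
  · lia

theorem le_indicator (hX : WindowMeasurable e q X) (r : ℝ) :
    WindowMeasurable e q fun n ω => if X n ω ≤ r then 1 else 0 := by
  intro m n h
  exact Measurable.ite (measurableSet_le (hX m n h) measurable_const)
    measurable_const measurable_const

theorem sub (hX : WindowMeasurable e q X) (hY : WindowMeasurable e q Y) :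
    WindowMeasurable e q fun n ω => X n ω - Y n ω :=
  fun m n h => (hX m n h).sub (hY m n h)

end WindowMeasurable

/-- The σ-algebra generated by the variables `e i` with `i ∈ S`. -/
abbrev noiseSigma {Ω : Type*} (e : ℤ → Ω → ℝ) (S : Set ℤ) : MeasurableSpace Ω :=
  ⨆ i ∈ S, MeasurableSpace.comap (e i) inferInstance

theorem measurable_noiseSigma {Ω : Type*} {e : ℤ → Ω → ℝ} {S : Set ℤ} {i : ℤ} (hi : i ∈ S) :
    Measurable[noiseSigma e S] (e i) :=
  measurable_iff_comap_le.2
    (le_iSup₂ (f := fun i _ => MeasurableSpace.comap (e i) inferInstance) i hi)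

theorem indep_past_future {Ω : Type*} [MeasurableSpace Ω] {μ : Measure Ω} {e : ℤ → Ω → ℝ}
    (he : ∀ n, Measurable (e n)) (hindep : iIndepFun e μ) (n : ℤ) :
    Indep (noiseSigma e (Set.Iic n)) (noiseSigma e (Set.Ioi n)) μ :=
  indep_iSup_of_disjoint (fun i => (he i).comap_le) hindep
    (Set.disjoint_left.2 fun _ hx hx' => (Set.mem_Ioi.1 hx').not_ge (Set.mem_Iic.1 hx))

theorem tsum_prod_mul_eq_sum_of_eq_zero {w u : ℕ → ℝ} {s m : ℕ} (hs : s < m) (hw : w s = 0) :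
    ∑' j, (∏ i ∈ Finset.range j, w i) * u j
      = ∑ j ∈ Finset.range m, (∏ i ∈ Finset.range j, w i) * u j := by
  refine tsum_eq_sum fun j hj => ?_
  rw [Finset.mem_range, not_lt] at hj
  rw [Finset.prod_eq_zero (Finset.mem_range.2 (hs.trans_le hj)) hw, zero_mul]

/-- Probability that a window-measurable process avoids `0` at `t` well separated times. -/
theorem measureReal_forall_ne_zero_le {Ω : Type*} [MeasurableSpace Ω] {μ : Measure Ω}
    [IsProbabilityMeasure μ] {e : ℤ → Ω → ℝ} (he : ∀ n, Measurable (e n))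
    (hindep : iIndepFun e μ) {q D : ℕ} (hD : q < D) {W : ℤ → Ω → ℝ}
    (hW : WindowMeasurable e q W) {p : ℝ} (hp : ∀ n, μ.real {ω | W n ω ≠ 0} ≤ p)
    (n : ℤ) (t : ℕ) :
    μ.real {ω | ∀ s < t, W (n - s * D) ω ≠ 0} ≤ p ^ t := by
  have hp0 : 0 ≤ p := measureReal_nonneg.trans (hp 0)
  induction t with
  | zero => simp
  | succ t ih =>
    have hset : {ω | ∀ s < t + 1, W (n - s * D) ω ≠ 0}
        = {ω | W (n - t * D) ω ≠ 0} ∩ {ω | ∀ s < t, W (n - s * D) ω ≠ 0} := by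
      ext ω
      simp only [Set.mem_ofPred_eq, Set.mem_inter_iff, Nat.forall_lt_succ_right]
      tauto
    have hlast : MeasurableSet[noiseSigma e (Set.Iic (n - t * D))]
        {ω | W (n - t * D) ω ≠ 0} :=
      (hW (noiseSigma e (Set.Iic (n - t * D))) _ fun i _ hi => measurable_noiseSigma hi)
        (measurableSet_singleton (0 : ℝ)).compl
    have hfirst : MeasurableSet[noiseSigma e (Set.Ioi (n - t * D))]
        {ω | ∀ s < t, W (n - s * D) ω ≠ 0} := by
      simp only [Set.ofPred_forall]
      refine MeasurableSet.iInter fun s => MeasurableSet.iInter fun hs => ?_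
      refine (hW (noiseSigma e (Set.Ioi (n - t * D))) _ fun i hi _ => measurable_noiseSigma ?_)
        (measurableSet_singleton (0 : ℝ)).compl
      have hst : ((s : ℤ) + 1) * D ≤ t * D :=
        mul_le_mul_of_nonneg_right (by exact_mod_cast hs) (by positivity)
      rw [Set.mem_Ioi]
      linarith [(by exact_mod_cast hD : (q : ℤ) < D)]
    rw [hset, measureReal_def,
      ((Indep_iff _ _ _).1 (indep_past_future he hindep _)) _ _ hlast hfirst,
      ENNReal.toReal_mul, pow_succ']
    exact mul_le_mul (hp _) ih measureReal_nonneg hp0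

theorem abs_measureReal_inter_sub_mul_le {Ω : Type*} [MeasurableSpace Ω] {μ : Measure Ω}
    [IsProbabilityMeasure μ] {A A' B B' N M : Set Ω} (hAB : μ (A' ∩ B') = μ A' * μ B')
    (hA : ∀ ω ∉ N, (ω ∈ A ↔ ω ∈ A')) (hB : ∀ ω ∉ M, (ω ∈ B ↔ ω ∈ B')) :
    |μ.real (A ∩ B) - μ.real A * μ.real B| ≤ 2 * (μ.real N + μ.real M) := by
  have key : ∀ {S T R : Set Ω}, (∀ ω ∉ R, (ω ∈ S ↔ ω ∈ T)) →
      |μ.real S - μ.real T| ≤ μ.real R := by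
    intro S T R h
    have h1 : μ.real S ≤ μ.real T + μ.real R :=
      (measureReal_mono fun ω hω => by
        by_cases hR : ω ∈ R
        · exact Or.inr hR
        · exact Or.inl ((h ω hR).1 hω)).trans (measureReal_union_le T R)
    have h2 : μ.real T ≤ μ.real S + μ.real R :=
      (measureReal_mono fun ω hω => by
        by_cases hR : ω ∈ R
        · exact Or.inr hR
        · exact Or.inl ((h ω hR).2 hω)).trans (measureReal_union_le S R)
    rw [abs_le]
    constructor <;> linarith
  have h1 : |μ.real (A ∩ B) - μ.real (A' ∩ B')| ≤ μ.real N + μ.real M := by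
    refine (key (R := N ∪ M) fun ω hω => ?_).trans (measureReal_union_le N M)
    rw [Set.mem_union, not_or] at hω
    exact and_congr (hA ω hω.1) (hB ω hω.2)
  have h2 := key hA
  have h3 := key hB
  have h4 : μ.real (A' ∩ B') = μ.real A' * μ.real B' := by
    rw [measureReal_def, hAB, ENNReal.toReal_mul]
    rfl
  have h5 : |(μ.real A' - μ.real A) * μ.real B'| ≤ μ.real N := by
    rw [abs_mul, abs_sub_comm, abs_of_nonneg (measureReal_nonneg (μ := μ) (s := B'))]
    exact (mul_le_of_le_one_right (abs_nonneg _) measureReal_le_one).trans h2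
  have h6 : |μ.real A * (μ.real B' - μ.real B)| ≤ μ.real M := by
    rw [abs_mul, abs_sub_comm (μ.real B'), abs_of_nonneg (measureReal_nonneg (μ := μ) (s := A))]
    exact (mul_le_of_le_one_left (abs_nonneg _) measureReal_le_one).trans h3
  rw [h4] at h1
  rw [abs_le] at *
  constructor <;> linarith

/-- Two moving averages are simultaneously below a level with probability bounded away from `0`. -/
theorem exists_pos_le_measureReal_both_le {Ω : Type*} [MeasurableSpace Ω] {μ : Measure Ω}
    [IsProbabilityMeasure μ] {e : ℤ → Ω → ℝ} (he : ∀ n, Measurable (e n))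
    (hindep : iIndepFun e μ) (hident : ∀ n, μ.map (e n) = μ.map (e 0))
    (hac : (volume : Measure ℝ) ≪ μ.map (e 0)) {q : ℕ} {r μ1 μ2 : ℝ} {φ ψ : ℕ → ℝ}
    {a b : ℤ → Ω → ℝ}
    (ha : ∀ n ω, a n ω = μ2 + e n ω + ∑ i ∈ Finset.Icc 1 q, ψ i * e (n - i) ω)
    (hb : ∀ n ω, b n ω = μ1 + e n ω + ∑ i ∈ Finset.Icc 1 q, φ i * e (n - i) ω) :
    ∃ c > 0, ∀ n, c ≤ μ.real {ω | a n ω ≤ r ∧ b n ω ≤ r} := by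
  set K : ℝ := |μ1| + |μ2| + |r| + ∑ i ∈ Finset.Icc 1 q, |φ i| + ∑ i ∈ Finset.Icc 1 q, |ψ i|
    with hK
  let S : ℕ → Set ℝ := fun i => if i = 0 then Set.Iic (-K) else Set.Icc (-1) 1
  have hS : ∀ i, MeasurableSet (S i) := fun i => by
    by_cases hi : i = 0 <;> simp [S, hi, measurableSet_Iic, measurableSet_Icc]
  have hS0 : ∀ i, μ.map (e 0) (S i) ≠ 0 := fun i h => by
    have := hac h
    by_cases hi : i = 0 <;> norm_num [S, hi] at this
  have : IsProbabilityMeasure (μ.map (e 0)) :=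
    Measure.isProbabilityMeasure_map (he 0).aemeasurable
  refine ⟨∏ i ∈ Finset.range (q + 1), (μ.map (e 0)).real (S i),
    Finset.prod_pos fun i _ => ENNReal.toReal_pos (hS0 i) (measure_ne_top _ _), fun n => ?_⟩
  have hinj : Function.Injective fun i : ℕ => n - (i : ℤ) := fun i j h => by
    simpa using h
  have hprod := (hindep.precomp hinj).measure_inter_preimage_eq_mul
    (Finset.range (q + 1)) (sets := S) fun i _ => hS i
  have heq : ∏ i ∈ Finset.range (q + 1), (μ.map (e 0)).real (S i)
      = μ.real (⋂ i ∈ Finset.range (q + 1), e (n - (i : ℤ)) ⁻¹' S i) := by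
    rw [measureReal_def, hprod, ENNReal.toReal_prod]
    refine Finset.prod_congr rfl fun i _ => ?_
    rw [← hident (n - i), measureReal_def, Measure.map_apply (he _) (hS i)]
  rw [heq]
  refine measureReal_mono fun ω hω => ?_
  simp only [Set.mem_iInter, Finset.mem_range, Set.mem_preimage] at hω
  have h0 : e n ω ≤ -K := by simpa [S] using hω 0 (by lia)
  have hsum : ∀ θ : ℕ → ℝ, ∑ i ∈ Finset.Icc 1 q, θ i * e (n - i) ω
      ≤ ∑ i ∈ Finset.Icc 1 q, |θ i| := fun θ => by
    refine Finset.sum_le_sum fun i hi => ?_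
    obtain ⟨hi1, hi2⟩ := Finset.mem_Icc.1 hi
    have hmem := hω i (by lia)
    rw [show S i = Set.Icc (-1) 1 from if_neg (by lia)] at hmem
    refine (le_abs_self _).trans ?_
    rw [abs_mul]
    exact mul_le_of_le_one_right (abs_nonneg _) (abs_le.2 hmem)
  have hφ : 0 ≤ ∑ i ∈ Finset.Icc 1 q, |φ i| := Finset.sum_nonneg fun _ _ => abs_nonneg _
  have hψ : 0 ≤ ∑ i ∈ Finset.Icc 1 q, |ψ i| := Finset.sum_nonneg fun _ _ => abs_nonneg _
  refine ⟨?_, ?_⟩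
  · rw [ha]
    linarith [hsum ψ, le_abs_self μ2, abs_nonneg μ1, neg_abs_le r]
  · rw [hb]
    linarith [hsum φ, le_abs_self μ1, abs_nonneg μ2, neg_abs_le r]

theorem exists_geometric_bound_of_pow_div {p : ℝ} (hp0 : 0 < p) (hp1 : p < 1) {L : ℕ}
    (hL : 0 < L) : ∃ ρ ∈ Set.Ioo (0 : ℝ) 1, ∀ k : ℕ, p ^ (k / L) ≤ p⁻¹ * ρ ^ k := by
  have hL' : (0 : ℝ) < (L : ℝ)⁻¹ := by positivity
  refine ⟨p ^ (L : ℝ)⁻¹, ⟨Real.rpow_pos_of_pos hp0 _, Real.rpow_lt_one hp0.le hp1 hL'⟩,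
    fun k => ?_⟩
  have hpow : (p ^ (L : ℝ)⁻¹) ^ L = p := Real.rpow_inv_natCast_pow hp0.le hL.ne'
  have hk : k ≤ L * (k / L + 1) := (Nat.lt_mul_div_succ k hL).le
  have hle : p ^ (k / L + 1) ≤ (p ^ (L : ℝ)⁻¹) ^ k := by
    calc p ^ (k / L + 1) = (p ^ (L : ℝ)⁻¹) ^ (L * (k / L + 1)) := by rw [pow_mul, hpow]
      _ ≤ _ := pow_le_pow_of_le_one (Real.rpow_pos_of_pos hp0 _).le
        (Real.rpow_lt_one hp0.le hp1 hL').le hk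
  rw [le_inv_mul_iff₀ hp0, ← pow_succ']
  exact hle

/-- Theorem 3.2: If the i.i.d. noise has a continuous, bounded and
strictly positive density on ℝ, then for the unique strictly stationary solution
`{y_n}` of the TMA(q) model there exist `ρ ∈ (0,1)` and `C > 0` such that for all
`u, v ∈ ℝ` and all `k ≥ 1`,
`|P(y_0 ≤ u, y_k ≤ v) − P(y_0 ≤ u)·P(y_k ≤ v)| ≤ C·ρ^k`. -/
theorem tma_joint_distribution_decay
    {Ω : Type*} [MeasureSpace Ω] [IsProbabilityMeasure (ℙ : Measure Ω)]
    (e : ℤ → Ω → ℝ)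
    (he : ∀ n, Measurable (e n))
    (hindep : iIndepFun e ℙ)
    (hident : ∀ n, Measure.map (e n) ℙ = Measure.map (e 0) ℙ)
    (f : ℝ → ℝ)
    (hf_cont : Continuous f)
    (hf_pos : ∀ x, 0 < f x)
    (hf_bdd : ∃ M, ∀ x, f x ≤ M)
    (hf_law : Measure.map (e 0) ℙ
      = (volume : Measure ℝ).withDensity fun x => ENNReal.ofReal (f x))
    (q d : ℕ) (hq : 0 < q) (hd : 0 < d)
    (r μ1 μ2 : ℝ) (φ ψ : ℕ → ℝ)
    (a b U W : ℤ → Ω → ℝ)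
    (ha : ∀ n ω, a n ω = μ2 + e n ω + ∑ i ∈ Finset.Icc 1 q, ψ i * e (n - i) ω)
    (hb : ∀ n ω, b n ω = μ1 + e n ω + ∑ i ∈ Finset.Icc 1 q, φ i * e (n - i) ω)
    (hU : ∀ n ω, U n ω = if a n ω ≤ r then 1 else 0)
    (hW : ∀ n ω, W n ω = (if b n ω ≤ r then 1 else 0) - (if a n ω ≤ r then 1 else 0))
    (α : ℤ → Ω → ℝ)
    (hα : ∀ n ω, α n ω =
      ∑' j : ℕ, (∏ s ∈ Finset.range j, W (n - (s : ℤ) * d) ω) * U (n - (j : ℤ) * d) ω)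
    (y : ℤ → Ω → ℝ)
    (hy : ∀ n ω, y n ω = a n ω + (b n ω - a n ω) * α (n - d) ω) :
    ∃ ρ ∈ Set.Ioo (0 : ℝ) 1, ∃ C > (0 : ℝ), ∀ u v : ℝ, ∀ k : ℕ, 1 ≤ k →
      |(ℙ {ω | y 0 ω ≤ u ∧ y (k : ℤ) ω ≤ v}).toReal
          - (ℙ {ω | y 0 ω ≤ u}).toReal * (ℙ {ω | y (k : ℤ) ω ≤ v}).toReal|
        ≤ C * ρ ^ k := by
  have haw : WindowMeasurable e q a := .movingAverage ha
  have hbw : WindowMeasurable e q b := .movingAverage hb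
  have hUw : WindowMeasurable e q U := by
    rw [funext₂ hU]
    exact haw.le_indicator r
  have hWw : WindowMeasurable e q W := by
    rw [funext₂ hW]
    exact (hbw.le_indicator r).sub (haw.le_indicator r)
  have hac : (volume : Measure ℝ) ≪ Measure.map (e 0) ℙ := by
    rw [hf_law]
    exact withDensity_absolutelyContinuous' hf_cont.measurable.ennreal_ofReal.aemeasurable
      (Eventually.of_forall fun x => (ENNReal.ofReal_pos.2 (hf_pos x)).ne')
  obtain ⟨c, hc, hcle⟩ := exists_pos_le_measureReal_both_le (r := r) he hindep hident hac ha hb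
  set p : ℝ := max (1 - c) (1 / 2) with hp_def
  have hp0 : 0 < p := lt_max_of_lt_right (by norm_num)
  have hp1 : p < 1 := max_lt (by linarith) (by norm_num)
  have hp : ∀ n, (ℙ : Measure Ω).real {ω | W n ω ≠ 0} ≤ p := by
    intro n
    have hmeas : MeasurableSet {ω | a n ω ≤ r ∧ b n ω ≤ r} :=
      (measurableSet_le (haw _ n fun i _ _ => he i) measurable_const).inter
        (measurableSet_le (hbw _ n fun i _ _ => he i) measurable_const)
    have hsub : {ω | W n ω ≠ 0} ⊆ {ω | a n ω ≤ r ∧ b n ω ≤ r}ᶜ := fun ω hω h =>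
      hω (by rw [hW, if_pos h.1, if_pos h.2, sub_self])
    refine (measureReal_mono hsub).trans ?_
    rw [probReal_compl_eq_one_sub hmeas]
    exact le_max_of_le_left (by linarith [hcle n])
  have hD : q < (q + 1) * d := (Nat.lt_succ_self q).trans_le (Nat.le_mul_of_pos_right _ hd)
  obtain ⟨ρ, hρ, hbound⟩ :=
    exists_geometric_bound_of_pow_div hp0 hp1 (L := (q + 1) * d + d + q) (by positivity)
  refine ⟨ρ, hρ, 4 * p⁻¹, by positivity, fun u v k _ => ?_⟩
  have hmain : ∀ t : ℕ, t * ((q + 1) * d + d + q) ≤ k →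
      |(ℙ : Measure Ω).real ({ω | y 0 ω ≤ u} ∩ {ω | y k ω ≤ v})
        - (ℙ : Measure Ω).real {ω | y 0 ω ≤ u} * (ℙ : Measure Ω).real {ω | y k ω ≤ v}|
          ≤ 4 * p ^ t := by
    intro t ht
    let z : ℤ → Ω → ℝ := fun n ω => a n ω + (b n ω - a n ω) *
      ∑ j ∈ Finset.range (t * (q + 1)), (∏ s ∈ Finset.range j, W (n - d - (s : ℤ) * d) ω)
        * U (n - d - (j : ℤ) * d) ω
    let N : ℤ → Set Ω := fun n => {ω | ∀ s < t, W (n - d - s * ((q + 1) * d : ℕ)) ω ≠ 0}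
    have hN : ∀ n, (ℙ : Measure Ω).real (N n) ≤ p ^ t := fun n =>
      measureReal_forall_ne_zero_le he hindep hD hWw hp (n - d) t
    have hyz : ∀ n, ∀ ω ∉ N n, y n ω = z n ω := by
      intro n ω hω
      simp only [N, Set.mem_ofPred_eq, not_forall, not_not] at hω
      obtain ⟨s, hs, hs0⟩ := hω
      rw [hy, hα]
      simp only [z]
      rw [tsum_prod_mul_eq_sum_of_eq_zero (w := fun s : ℕ => W (n - d - (s : ℤ) * d) ω)
        (s := s * (q + 1)) (m := t * (q + 1)) (by gcongr)]
      rw [← hs0]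
      push_cast
      ring_nf
    have hd' : (0 : ℤ) < d := by exact_mod_cast hd
    have hz : ∀ (m : MeasurableSpace Ω) (n : ℤ),
        (∀ i, n - q - d - t * (q + 1) * d < i → i ≤ n → Measurable[m] (e i)) →
        Measurable[m] (z n) := by
      intro m n h
      have hpast : ∀ {X : ℤ → Ω → ℝ}, WindowMeasurable e q X → ∀ j : ℕ, j < t * (q + 1) →
          Measurable[m] (X (n - d - j * d)) := by
        intro X hX j hj
        have hjd : (j : ℤ) * d < t * (q + 1) * d :=
          mul_lt_mul_of_pos_right (by exact_mod_cast hj) hd'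
        have hjd0 : (0 : ℤ) ≤ j * d := by positivity
        exact hX m _ fun i hi hi' => h i (by linarith) (by linarith)
      have hcur : ∀ {X : ℤ → Ω → ℝ}, WindowMeasurable e q X → Measurable[m] (X n) := by
        intro X hX
        have htd : (0 : ℤ) ≤ t * (q + 1) * d := by positivity
        exact hX m n fun i hi hi' => h i (by linarith) hi'
      refine (hcur haw).add (((hcur hbw).sub (hcur haw)).mul
        (Finset.measurable_fun_sum _ fun j hj => ?_))
      rw [Finset.mem_range] at hj
      exact (Finset.measurable_fun_prod _ fun s hs =>
        hpast hWw s ((Finset.mem_range.1 hs).trans hj)).mul (hpast hUw j hj)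
    rcases Nat.eq_zero_or_pos t with rfl | ht0
    · refine (abs_measureReal_inter_sub_mul_le (A' := ∅) (B' := ∅) (N := Set.univ)
        (M := Set.univ) (by simp) (by simp) (by simp)).trans ?_
      norm_num
    have hk : (0 : ℤ) ≤ k - q - d - t * (q + 1) * d := by
      have h1 : (t : ℤ) * ((q + 1) * d + d + q) ≤ k := by exact_mod_cast ht
      have h2 : (1 : ℤ) * (d + q) ≤ t * (d + q) :=
        mul_le_mul_of_nonneg_right (by exact_mod_cast ht0) (by positivity)
      linarith
    have hindep' : (ℙ : Measure Ω) ({ω | z 0 ω ≤ u} ∩ {ω | z k ω ≤ v})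
        = (ℙ : Measure Ω) {ω | z 0 ω ≤ u} * (ℙ : Measure Ω) {ω | z k ω ≤ v} :=
      (Indep_iff _ _ _).1 (indep_past_future he hindep 0) _ _
        ((hz (noiseSigma e (Set.Iic 0)) 0 fun i _ hi => measurable_noiseSigma hi)
          measurableSet_Iic)
        ((hz (noiseSigma e (Set.Ioi 0)) k fun i hi _ => measurable_noiseSigma (hk.trans_lt hi))
          measurableSet_Iic)
    refine (abs_measureReal_inter_sub_mul_le (N := N 0) (M := N k) hindep'
      (fun ω hω => ?_) (fun ω hω => ?_)).trans (by linarith [hN 0, hN k])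
    · simp only [Set.mem_ofPred_eq, hyz 0 ω hω]
    · simp only [Set.mem_ofPred_eq, hyz k ω hω]
  refine (hmain _ (Nat.div_mul_le_self _ _)).trans ?_
  rw [mul_assoc]
  exact mul_le_mul_of_nonneg_left (hbound k) (by norm_num)
end

section
/- Let {e_n} be i.i.d. with mean 0, finite variance σ² > 0 and distribution function G, satisfying the non-degeneracy condition, and let {y_n} be the unique strictly stationary solution of y_n = μ1 + e_n if y_{n−1} ≤ r and y_n = μ2 + e_n if y_{n−1} > r. Set β = G(r−μ1) − G(r−μ2), δ0 = G(r−μ2)/[1 − G(r−μ1) + G(r−μ2)], and λ_k = E[e_{n−k}·1(y_{n−1} ≤ r)]. Then β ∈ (−1, 1), and for every k ≥ 1 the ACF of {y_n} equals ρ_k = [(μ1−μ2)·λ_k + (μ1−μ2)²·δ0·(1−δ0)·β^k] / [σ² + (μ1−μ2)²·δ0·(1−δ0)]. -/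
open MeasureTheory ProbabilityTheory Filter Finset

/-- A variable independent of the past of a process factors out of expectations against
functions of two past coordinates. -/
lemma integral_mul_past {Ω : Type*} [MeasurableSpace Ω] {P : Measure Ω} {X : Ω → ℝ}
    {y : ℤ → Ω → ℝ} (hX : Measurable X) (hy : ∀ n, Measurable (y n)) {n : ℤ}
    (h : IndepFun X (fun ω => fun k : ℕ => y (n - 1 - k) ω) P)
    {p q : ℤ} (hp : p ≤ n - 1) (hq : q ≤ n - 1) {f : ℝ → ℝ} (hf : Measurable f)
    {g : ℝ × ℝ → ℝ} (hg : Measurable g) :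
    ∫ ω, f (X ω) * g (y p ω, y q ω) ∂P = (∫ ω, f (X ω) ∂P) * ∫ ω, g (y p ω, y q ω) ∂P := by
  have hsel : Measurable fun u : ℕ → ℝ => g (u (n - 1 - p).toNat, u (n - 1 - q).toNat) := by
    fun_prop
  have hcomp := h.comp hf hsel
  have hp' : n - 1 - ((n - 1 - p).toNat : ℤ) = p := by omega
  have hq' : n - 1 - ((n - 1 - q).toNat : ℤ) = q := by omega
  have key := hcomp.integral_fun_mul_eq_mul_integral
    (hf.comp hX).aestronglyMeasurable
    (hsel.comp (measurable_pi_lambda _ fun k : ℕ => hy (n - 1 - k))).aestronglyMeasurable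
  simpa only [Function.comp_def, hp', hq'] using key

/-- The difference of a distribution function at two points lies strictly between `-1` and `1`
as soon as the variable falls on the same side of both points with positive probability. -/
lemma cdf_sub_mem_Ioo {Ω : Type*} [MeasurableSpace Ω] {P : Measure Ω} [IsProbabilityMeasure P]
    {X : Ω → ℝ} (hX : Measurable X) {a b : ℝ}
    (h : P {ω | X ω ≤ b ∧ X ω ≤ a} + P {ω | b < X ω ∧ a < X ω} ≠ 0) :
    -1 < P.real {ω | X ω ≤ a} - P.real {ω | X ω ≤ b} ∧
      P.real {ω | X ω ≤ a} - P.real {ω | X ω ≤ b} < 1 := by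
  wlog hab : a ≤ b generalizing a b
  · have := this (a := b) (b := a) (by simpa only [and_comm] using h) (le_of_not_ge hab)
    constructor <;> linarith [this.1, this.2]
  have hA : {ω | X ω ≤ b ∧ X ω ≤ a} = {ω | X ω ≤ a} := by
    ext ω; exact ⟨fun h => h.2, fun h => ⟨le_trans h hab, h⟩⟩
  have hB : {ω | b < X ω ∧ a < X ω} = {ω | X ω ≤ b}ᶜ := by
    ext ω; simp only [Set.mem_ofPred_eq, Set.mem_compl_iff, not_le]
    exact ⟨fun h => h.1, fun h => ⟨h, lt_of_le_of_lt hab h⟩⟩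
  rw [hA, hB] at h
  have hmeas : MeasurableSet {ω | X ω ≤ b} := measurableSet_le hX measurable_const
  have hle : P.real {ω | X ω ≤ a} ≤ P.real {ω | X ω ≤ b} :=
    measureReal_mono fun ω hω => le_trans hω hab
  have hpos : 0 < P.real {ω | X ω ≤ a} + P.real {ω | X ω ≤ b}ᶜ := by
    rw [measureReal_def, measureReal_def,
      ← ENNReal.toReal_add (measure_ne_top _ _) (measure_ne_top _ _)]
    exact ENNReal.toReal_pos h (ENNReal.add_ne_top.2 ⟨measure_ne_top _ _, measure_ne_top _ _⟩)
  rw [probReal_compl_eq_one_sub hmeas] at hpos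
  constructor <;> linarith

/-- Indicator of the lower regime `(-∞, r]`, with values in `ℝ`. -/
noncomputable def lowerRegime (r x : ℝ) : ℝ := if x ≤ r then 1 else 0

lemma measurable_lowerRegime (r : ℝ) : Measurable (lowerRegime r) :=
  Measurable.ite measurableSet_Iic measurable_const measurable_const

lemma norm_lowerRegime_le (r x : ℝ) : ‖lowerRegime r x‖ ≤ 1 := by
  unfold lowerRegime; split_ifs <;> simp

lemma lowerRegime_mul_self (r x : ℝ) : lowerRegime r x * lowerRegime r x = lowerRegime r x := by
  unfold lowerRegime; split_ifs <;> simp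

lemma integral_lowerRegime {Ω : Type*} [MeasurableSpace Ω] {P : Measure Ω} {X : Ω → ℝ}
    (hX : Measurable X) (c : ℝ) : ∫ ω, lowerRegime c (X ω) ∂P = P.real {ω | X ω ≤ c} := by
  have : (fun ω => lowerRegime c (X ω)) = {ω | X ω ≤ c}.indicator 1 := by
    ext ω; simp [lowerRegime, Set.indicator_apply]
  rw [this, integral_indicator_one (measurableSet_le hX measurable_const)]

/-- Bounded functions of measurable variables may multiply integrable ones. -/
lemma integrable_comp_mul {Ω : Type*} [MeasurableSpace Ω] {P : Measure Ω} {X Z : Ω → ℝ}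
    (hX : Measurable X) {φ : ℝ → ℝ} (hφ : Measurable φ) {C : ℝ} (hC : ∀ x, ‖φ x‖ ≤ C)
    (hZ : Integrable Z P) : Integrable (fun ω => φ (X ω) * Z ω) P :=
  hZ.bdd_mul (hφ.comp hX).aestronglyMeasurable (Eventually.of_forall fun ω => hC (X ω))

/-- One step of the regime chain, tested against a bounded function of a past value. -/
lemma integral_mul_lowerRegime_succ {Ω : Type*} [MeasurableSpace Ω] {P : Measure Ω}
    [IsProbabilityMeasure P] {X : Ω → ℝ} {y : ℤ → Ω → ℝ} {μ1 μ2 r : ℝ}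
    (hX : Measurable X) (hy : ∀ n, Measurable (y n)) {n : ℤ}
    (hmodel : ∀ᵐ ω ∂P, y n ω = if y (n - 1) ω ≤ r then μ1 + X ω else μ2 + X ω)
    (h : IndepFun X (fun ω => fun k : ℕ => y (n - 1 - k) ω) P)
    {p : ℤ} (hp : p ≤ n - 1) {φ : ℝ → ℝ} (hφ : Measurable φ) {C : ℝ} (hC : ∀ x, ‖φ x‖ ≤ C) :
    ∫ ω, φ (y p ω) * lowerRegime r (y n ω) ∂P
      = (P.real {ω | X ω ≤ r - μ1} - P.real {ω | X ω ≤ r - μ2})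
          * (∫ ω, φ (y p ω) * lowerRegime r (y (n - 1) ω) ∂P)
        + P.real {ω | X ω ≤ r - μ2} * ∫ ω, φ (y p ω) ∂P := by
  have hm := measurable_lowerRegime
  have hstep : (fun ω => φ (y p ω) * lowerRegime r (y n ω)) =ᵐ[P] fun ω =>
      (lowerRegime (r - μ1) (X ω) * (φ (y p ω) * lowerRegime r (y (n - 1) ω))
        - lowerRegime (r - μ2) (X ω) * (φ (y p ω) * lowerRegime r (y (n - 1) ω)))
        + lowerRegime (r - μ2) (X ω) * φ (y p ω) := by
    filter_upwards [hmodel] with ω hω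
    rw [hω]
    by_cases hr : y (n - 1) ω ≤ r
    · simp only [lowerRegime, hr, if_true, le_sub_iff_add_le, add_comm μ1]
      ring
    · simp only [lowerRegime, hr, if_false, le_sub_iff_add_le, add_comm μ2]
      ring
  have hφi : Integrable (fun ω => φ (y p ω)) P := by
    simpa using integrable_comp_mul (hy p) hφ hC (integrable_const (1 : ℝ))
  have hφJ : Integrable (fun ω => φ (y p ω) * lowerRegime r (y (n - 1) ω)) P := by
    refine integrable_comp_mul (hy p) hφ hC ?_
    simpa using integrable_comp_mul (hy (n - 1)) (hm r) (norm_lowerRegime_le r)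
      (integrable_const (1 : ℝ))
  have hi (c : ℝ) := integrable_comp_mul hX (hm c) (norm_lowerRegime_le c) hφJ
  have hi' (c : ℝ) := integrable_comp_mul hX (hm c) (norm_lowerRegime_le c) hφi
  have hsub : Integrable (fun ω =>
      lowerRegime (r - μ1) (X ω) * (φ (y p ω) * lowerRegime r (y (n - 1) ω))
        - lowerRegime (r - μ2) (X ω) * (φ (y p ω) * lowerRegime r (y (n - 1) ω))) P :=
    (hi _).sub (hi _)
  have hfac (c : ℝ) := integral_mul_past hX hy h hp le_rfl (hm c)
    (g := fun z => φ z.1 * lowerRegime r z.2)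
    ((hφ.comp measurable_fst).mul ((hm r).comp measurable_snd))
  have hfac' (c : ℝ) := integral_mul_past hX hy h hp hp (hm c) (g := fun z => φ z.1)
    (hφ.comp measurable_fst)
  simp only at hfac hfac'
  rw [integral_congr_ae hstep, integral_add hsub (hi' _),
    integral_sub (hi _) (hi _), hfac, hfac, hfac', integral_lowerRegime hX,
    integral_lowerRegime hX]
  ring

/-- Example 1: For the model `y_n = μ1 + e_n` if `y_{n−1} ≤ r`,
`y_n = μ2 + e_n` if `y_{n−1} > r`, with i.i.d. noise of mean 0, variance `σ² > 0`
and distribution function `G`, satisfying the non-degeneracy condition, and `{y_n}`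
the (unique) strictly stationary solution: with `β = G(r−μ1) − G(r−μ2)`,
`δ0 = G(r−μ2)/(1 − G(r−μ1) + G(r−μ2))` and `λ_k = E[e_{n−k}·1(y_{n−1} ≤ r)]`
(taken at `n = k`), one has `β ∈ (−1,1)` and, for every `k ≥ 1`,
`ρ_k = [(μ1−μ2)λ_k + (μ1−μ2)²δ0(1−δ0)β^k] / [σ² + (μ1−μ2)²δ0(1−δ0)]`. -/
theorem tar_example_acf
    {Ω : Type*} [MeasureSpace Ω] [IsProbabilityMeasure (ℙ : Measure Ω)]
    (e : ℤ → Ω → ℝ)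
    (he : ∀ n, Measurable (e n))
    (hindep : iIndepFun e ℙ)
    (hident : ∀ n, Measure.map (e n) ℙ = Measure.map (e 0) ℙ)
    (σ2 : ℝ) (hσ2 : 0 < σ2)
    (hmean : ∫ ω, e 0 ω ∂ℙ = 0)
    (hint2 : Integrable (fun ω => (e 0 ω) ^ 2) ℙ)
    (hvar : ∫ ω, (e 0 ω) ^ 2 ∂ℙ = σ2)
    (G : ℝ → ℝ) (hG : ∀ x, G x = (ℙ {ω | e 0 ω ≤ x}).toReal)
    (μ1 μ2 r : ℝ)
    (hnd : ℙ {ω | e 0 ω ≤ r - μ2 ∧ e 0 ω ≤ r - μ1}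
      + ℙ {ω | r - μ2 < e 0 ω ∧ r - μ1 < e 0 ω} ≠ 0)
    (y : ℤ → Ω → ℝ)
    (hy_meas : ∀ n, Measurable (y n))
    (hmodel : ∀ n : ℤ, ∀ᵐ ω ∂ℙ,
      y n ω = if y (n - 1) ω ≤ r then μ1 + e n ω else μ2 + e n ω)
    (hpast : ∀ n : ℤ, IndepFun (e n) (fun ω => fun k : ℕ => y (n - 1 - k) ω) ℙ)
    (hstat : ∀ (k : ℕ) (h : ℤ),
      Measure.map (fun ω => fun i : Fin k => (y ((i : ℤ) + h) ω, e ((i : ℤ) + h) ω)) ℙ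
        = Measure.map (fun ω => fun i : Fin k => (y (i : ℤ) ω, e (i : ℤ) ω)) ℙ) :
    (-1 < G (r - μ1) - G (r - μ2) ∧ G (r - μ1) - G (r - μ2) < 1) ∧
    ∀ k : ℕ, 1 ≤ k →
      (∫ ω, (y 0 ω - ∫ x, y 0 x ∂ℙ) * (y (k : ℤ) ω - ∫ x, y (k : ℤ) x ∂ℙ) ∂ℙ)
          / (∫ ω, (y 0 ω - ∫ x, y 0 x ∂ℙ) ^ 2 ∂ℙ)
        = ((μ1 - μ2)
              * (∫ ω, e 0 ω * (if y ((k : ℤ) - 1) ω ≤ r then (1 : ℝ) else 0) ∂ℙ)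
            + (μ1 - μ2) ^ 2
              * (G (r - μ2) / (1 - G (r - μ1) + G (r - μ2)))
              * (1 - G (r - μ2) / (1 - G (r - μ1) + G (r - μ2)))
              * (G (r - μ1) - G (r - μ2)) ^ k)
          / (σ2 + (μ1 - μ2) ^ 2
              * (G (r - μ2) / (1 - G (r - μ1) + G (r - μ2)))
              * (1 - G (r - μ2) / (1 - G (r - μ1) + G (r - μ2)))) := by
  have hGreal : ∀ n x, (ℙ : Measure Ω).real {ω | e n ω ≤ x} = G x := by
    intro n x
    rw [hG, measureReal_def]
    congr 1
    have := congrArg (fun ν => ν (Set.Iic x)) (hident n)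
    simpa [Measure.map_apply (he _) measurableSet_Iic, Set.preimage] using this
  have hβ : -1 < G (r - μ1) - G (r - μ2) ∧ G (r - μ1) - G (r - μ2) < 1 := by
    simpa only [hGreal] using cdf_sub_mem_Ioo (he 0) hnd
  refine ⟨hβ, fun k hk => ?_⟩
  have hm := measurable_lowerRegime r
  have hid : ∀ n, IdentDistrib (e n) (e 0) ℙ ℙ := fun n =>
    ⟨(he n).aemeasurable, (he 0).aemeasurable, hident n⟩
  have hL2 : ∀ n, MemLp (e n) 2 ℙ := fun n =>
    (hid n).memLp_iff.2 ((memLp_two_iff_integrable_sq (he 0).aestronglyMeasurable).2 hint2)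
  have he_int : ∀ n, Integrable (e n) ℙ := fun n => (hL2 n).integrable (by norm_num)
  have he_mean : ∀ n, ∫ ω, e n ω ∂ℙ = 0 := fun n => (hid n).integral_eq.trans hmean
  have hJi : ∀ n, Integrable (fun ω => lowerRegime r (y n ω)) ℙ := fun n => by
    simpa using integrable_comp_mul (hy_meas n) hm (norm_lowerRegime_le r)
      (integrable_const (1 : ℝ))
  have hJstat : ∀ n, ∫ ω, lowerRegime r (y n ω) ∂ℙ = ∫ ω, lowerRegime r (y 0 ω) ∂ℙ := by
    intro n
    have hf : Measurable fun u : Fin 1 → ℝ × ℝ => lowerRegime r (u 0).1 := by fun_prop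
    have hv : ∀ h : ℤ, Measurable
        (fun ω => fun i : Fin 1 => (y ((i : ℤ) + h) ω, e ((i : ℤ) + h) ω)) := fun h =>
      measurable_pi_lambda _ fun i => (hy_meas _).prodMk (he _)
    have hv0 : Measurable (fun ω => fun i : Fin 1 => (y (i : ℤ) ω, e (i : ℤ) ω)) :=
      measurable_pi_lambda _ fun i => (hy_meas _).prodMk (he _)
    have := congrArg (fun ν => ∫ u, lowerRegime r (u 0).1 ∂ν) (hstat 1 n)
    rw [integral_map (hv n).aemeasurable hf.aestronglyMeasurable,
      integral_map hv0.aemeasurable hf.aestronglyMeasurable] at this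
    simpa using this
  set β := G (r - μ1) - G (r - μ2) with hβdef
  set δ := G (r - μ2) / (1 - G (r - μ1) + G (r - μ2)) with hδ
  have hden : 1 - G (r - μ1) + G (r - μ2) ≠ 0 := by linarith [hβ.2]
  have hstep : ∀ (n p : ℤ), p ≤ n - 1 → ∀ φ : ℝ → ℝ, Measurable φ → ∀ C, (∀ x, ‖φ x‖ ≤ C) →
      ∫ ω, φ (y p ω) * lowerRegime r (y n ω) ∂ℙ
        = β * (∫ ω, φ (y p ω) * lowerRegime r (y (n - 1) ω) ∂ℙ)
          + G (r - μ2) * ∫ ω, φ (y p ω) ∂ℙ := by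
    intro n p hp φ hφ C hC
    simpa only [hGreal] using
      integral_mul_lowerRegime_succ (he n) hy_meas (hmodel n) (hpast n) hp hφ hC
  have hJ : ∀ n, ∫ ω, lowerRegime r (y n ω) ∂ℙ = δ := by
    have h1 := hstep 0 (-1) (by norm_num) (fun _ => 1) measurable_const 1 (by simp)
    simp only [one_mul, integral_const, probReal_univ, smul_eq_mul, mul_one] at h1
    rw [hJstat (0 - 1)] at h1
    intro n
    rw [hJstat n, hδ, eq_div_iff hden]
    linear_combination h1
  have hK : Measurable fun x => lowerRegime r x - δ := hm.sub_const δ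
  have hKb : ∀ x, ‖lowerRegime r x - δ‖ ≤ 1 + ‖δ‖ := fun x =>
    (norm_sub_le _ _).trans (by gcongr; exact norm_lowerRegime_le r x)
  have hKi : ∀ n, Integrable (fun ω => lowerRegime r (y n ω) - δ) ℙ := fun n =>
    (hJi n).sub (integrable_const δ)
  have hKmean : ∀ n, ∫ ω, (lowerRegime r (y n ω) - δ) ∂ℙ = 0 := by
    intro n
    rw [integral_sub (hJi n) (integrable_const δ), hJ n]
    simp
  have hKJi : ∀ p q, Integrable
      (fun ω => (lowerRegime r (y p ω) - δ) * lowerRegime r (y q ω)) ℙ := fun p q =>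
    integrable_comp_mul (hy_meas p) hK hKb (hJi q)
  have hKKi : ∀ p q, Integrable
      (fun ω => (lowerRegime r (y p ω) - δ) * (lowerRegime r (y q ω) - δ)) ℙ := fun p q =>
    integrable_comp_mul (hy_meas p) hK hKb (hKi q)
  have hKei : ∀ p q, Integrable (fun ω => (lowerRegime r (y p ω) - δ) * e q ω) ℙ := fun p q =>
    integrable_comp_mul (hy_meas p) hK hKb (he_int q)
  have hKK_eq : ∀ p q, ∫ ω, (lowerRegime r (y p ω) - δ) * (lowerRegime r (y q ω) - δ) ∂ℙ
      = ∫ ω, (lowerRegime r (y p ω) - δ) * lowerRegime r (y q ω) ∂ℙ := by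
    intro p q
    simp only [mul_sub _ (lowerRegime r (y q _)) δ]
    rw [integral_sub (hKJi p q) ((hKi p).mul_const δ), integral_mul_const, hKmean p]
    simp
  have hKJ : ∀ j : ℕ, ∫ ω, (lowerRegime r (y (-1) ω) - δ) * lowerRegime r (y (-1 + j) ω) ∂ℙ
      = δ * (1 - δ) * β ^ j := by
    intro j
    induction j with
    | zero =>
      simp only [Nat.cast_zero, add_zero, sub_mul, lowerRegime_mul_self]
      rw [integral_sub (hJi _) ((hJi _).const_mul δ), integral_const_mul, hJ]
      ring
    | succ j ih =>
      have h1 := hstep (-1 + (j + 1 : ℕ)) (-1) (by push_cast; omega) _ hK _ hKb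
      simp only [hKmean] at h1
      rw [h1, show (-1 + ((j + 1 : ℕ) : ℤ) - 1) = -1 + j by push_cast; ring, ih]
      ring
  have hKe : ∀ p q, p ≤ q - 1 → ∫ ω, (lowerRegime r (y p ω) - δ) * e q ω ∂ℙ = 0 := by
    intro p q hpq
    have h1 := integral_mul_past (he q) hy_meas (hpast q) hpq hpq measurable_id
      (g := fun z => lowerRegime r z.1 - δ) (hK.comp measurable_fst)
    simp only [id, he_mean, zero_mul] at h1
    simpa only [mul_comm] using h1
  have hcent_model : ∀ n, (fun ω => y n ω) =ᵐ[ℙ] fun ω =>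
      (μ1 - μ2) * (lowerRegime r (y (n - 1) ω) - δ) + e n ω + (μ2 + (μ1 - μ2) * δ) := by
    intro n
    filter_upwards [hmodel n] with ω hω
    rw [hω]
    unfold lowerRegime
    split_ifs <;> ring
  have hymean : ∀ n, ∫ ω, y n ω ∂ℙ = μ2 + (μ1 - μ2) * δ := by
    intro n
    rw [integral_congr_ae (hcent_model n),
      integral_add (((hKi _).const_mul _).fun_add (he_int n)) (integrable_const _),
      integral_add ((hKi _).const_mul _) (he_int n), integral_const_mul, hKmean, he_mean]
    simp
  have hcent : ∀ n, ∀ᵐ ω ∂ℙ, y n ω - ∫ x, y n x ∂ℙ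
      = (μ1 - μ2) * (lowerRegime r (y (n - 1) ω) - δ) + e n ω := by
    intro n
    filter_upwards [hcent_model n] with ω hω
    rw [hymean, hω]
    ring
  have heei : ∀ p q, Integrable (fun ω => e p ω * e q ω) ℙ := fun p q =>
    (hL2 p).integrable_mul (hL2 q)
  have hprod : ∀ n, ∫ ω, (y 0 ω - ∫ x, y 0 x ∂ℙ) * (y n ω - ∫ x, y n x ∂ℙ) ∂ℙ
      = (μ1 - μ2) ^ 2
          * (∫ ω, (lowerRegime r (y (-1) ω) - δ) * lowerRegime r (y (n - 1) ω) ∂ℙ)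
        + (μ1 - μ2) * (∫ ω, (lowerRegime r (y (n - 1) ω) - δ) * e 0 ω ∂ℙ)
        + (μ1 - μ2) * (∫ ω, (lowerRegime r (y (-1) ω) - δ) * e n ω ∂ℙ)
        + ∫ ω, e 0 ω * e n ω ∂ℙ := by
    intro n
    have hexp : (fun ω => (y 0 ω - ∫ x, y 0 x ∂ℙ) * (y n ω - ∫ x, y n x ∂ℙ)) =ᵐ[ℙ] fun ω =>
        (μ1 - μ2) ^ 2 * ((lowerRegime r (y (-1) ω) - δ) * (lowerRegime r (y (n - 1) ω) - δ))
        + (μ1 - μ2) * ((lowerRegime r (y (n - 1) ω) - δ) * e 0 ω)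
        + (μ1 - μ2) * ((lowerRegime r (y (-1) ω) - δ) * e n ω)
        + e 0 ω * e n ω := by
      filter_upwards [hcent 0, hcent n] with ω h0 hn
      rw [h0, hn, zero_sub]
      ring
    have i1 := (hKKi (-1) (n - 1)).const_mul ((μ1 - μ2) ^ 2)
    have i2 := (hKei (n - 1) 0).const_mul (μ1 - μ2)
    have i3 := (hKei (-1) n).const_mul (μ1 - μ2)
    rw [integral_congr_ae hexp, integral_add ((i1.fun_add i2).fun_add i3) (heei 0 n),
      integral_add (i1.fun_add i2) i3, integral_add i1 i2, integral_const_mul, integral_const_mul,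
      integral_const_mul, hKK_eq]
  have hnum := hprod k
  have hvar0 := hprod 0
  have hindep0 : ∫ ω, e 0 ω * e (k : ℤ) ω ∂ℙ = 0 := by
    have hne : (0 : ℤ) ≠ k := by omega
    rw [(hindep.indepFun hne).integral_fun_mul_eq_mul_integral
      (he _).aestronglyMeasurable (he _).aestronglyMeasurable, hmean, zero_mul]
  have hlam : ∫ ω, (lowerRegime r (y ((k : ℤ) - 1) ω) - δ) * e 0 ω ∂ℙ
      = ∫ ω, e 0 ω * (if y ((k : ℤ) - 1) ω ≤ r then (1 : ℝ) else 0) ∂ℙ := by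
    have hi := integrable_comp_mul (hy_meas ((k : ℤ) - 1)) hm (norm_lowerRegime_le r) (he_int 0)
    simp only [sub_mul]
    rw [integral_sub hi ((he_int 0).const_mul δ), integral_const_mul, hmean, mul_zero, sub_zero]
    simp only [mul_comm (e 0 _), lowerRegime]
  rw [hKe (-1) k (by omega), hindep0, hlam, show (k : ℤ) - 1 = -1 + k by ring, hKJ k] at hnum
  have hKJ0 := hKJ 0
  simp only [Nat.cast_zero, add_zero, pow_zero, mul_one] at hKJ0
  rw [zero_sub, hKe (-1) 0 (by norm_num), hKJ0] at hvar0
  simp only [← pow_two] at hvar0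
  rw [hvar] at hvar0
  rw [hnum, hvar0, show (k : ℤ) - 1 = -1 + k by ring]
  congr 1 <;> ring
end

section
/- Let {e_n} be i.i.d. with mean 0, finite variance σ² > 0, finite third and fourth moments, and distribution function G, and let {y_n} be the unique strictly stationary solution of y_n = μ1 + e_n if y_{n−1} ≤ r and y_n = μ2 + e_n if y_{n−1} > r, with δ0 = G(r−μ2)/[1 − G(r−μ1) + G(r−μ2)]. Then the skewness of y_n equals [E e_1³ + (μ1−μ2)³·(δ0 − 3δ0² + 2δ0³)] / [σ² + (μ1−μ2)²·δ0·(1−δ0)]^{3/2}, i.e. E[(y_n − E y_n)³]/Var(y_n)^{3/2} equals this expression. -/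
open MeasureTheory ProbabilityTheory Filter Finset

/-- If `J` is integrable and independent of `X`, then integrals of `(a + b J) X ^ k`
factorise. -/
lemma integrable_and_integral_affine_mul_pow_of_indepFun {Ω : Type*} [MeasurableSpace Ω]
    {P : Measure Ω} [IsProbabilityMeasure P] {X J : Ω → ℝ} (hXJ : IndepFun X J P)
    (hJ : Integrable J P) {k : ℕ} (hX : Integrable (fun ω => X ω ^ k) P) (a b : ℝ) :
    Integrable (fun ω => (a + b * J ω) * X ω ^ k) P ∧
      ∫ ω, (a + b * J ω) * X ω ^ k ∂P = (a + b * ∫ ω, J ω ∂P) * ∫ ω, X ω ^ k ∂P := by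
  have hind : IndepFun (fun ω => a + b * J ω) (fun ω => X ω ^ k) P :=
    hXJ.symm.comp (φ := fun x => a + b * x) (ψ := fun x => x ^ k) (by fun_prop) (by fun_prop)
  have haff : Integrable (fun ω => a + b * J ω) P := (integrable_const a).add (hJ.const_mul b)
  refine ⟨hind.integrable_mul haff hX, ?_⟩
  rw [hind.integral_fun_mul_eq_mul_integral haff.aestronglyMeasurable hX.aestronglyMeasurable,
    integral_add (integrable_const a) (hJ.const_mul b), integral_const_mul]
  simp

/-- Mean and central moments of order two and three of `m + d J + X`, where `X` is centred and
independent of the zero-one valued variable `J`. -/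
lemma central_moments_add_indicator_add {Ω : Type*} [MeasurableSpace Ω]
    {P : Measure Ω} [IsProbabilityMeasure P] {X J Y : Ω → ℝ} (hXJ : IndepFun X J P)
    (hJ : Integrable J P) (hJsq : ∀ ω, J ω ^ 2 = J ω) (hX : MemLp X 3 P)
    (hX0 : ∫ ω, X ω ∂P = 0) (m d : ℝ) (hY : ∀ᵐ ω ∂P, Y ω = m + d * J ω + X ω) {p : ℝ}
    (hp : ∫ ω, J ω ∂P = p) :
    ∫ ω, Y ω ∂P = m + d * p ∧
      ∫ ω, (Y ω - (m + d * p)) ^ 2 ∂P = ∫ ω, X ω ^ 2 ∂P + d ^ 2 * p * (1 - p) ∧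
      ∫ ω, (Y ω - (m + d * p)) ^ 3 ∂P
        = ∫ ω, X ω ^ 3 ∂P + d ^ 3 * (p - 3 * p ^ 2 + 2 * p ^ 3) := by
  have hpow : ∀ k : ℕ, k ≤ 3 → Integrable (fun ω => X ω ^ k) P := by
    intro k hk
    have h : MemLp X (k : ENNReal) P := hX.mono_exponent (by exact_mod_cast hk)
    refine (integrable_norm_iff (hX.1.pow k)).1 ?_
    simpa using h.integrable_norm_pow'
  have key := fun (k : ℕ) (hk : k ≤ 3) =>
    integrable_and_integral_affine_mul_pow_of_indepFun hXJ hJ (hpow k hk)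
  simp only [hp] at key
  have hX1 : ∫ ω, X ω ^ 1 ∂P = 0 := by simpa using hX0
  have hX00 : ∫ ω, X ω ^ 0 ∂P = 1 := by simp
  refine ⟨?_, ?_, ?_⟩
  · have h0 := key 0 (by norm_num) m d
    have h1 := key 1 (by norm_num) 1 0
    have h : ∫ ω, Y ω ∂P = ∫ ω, ((m + d * J ω) * X ω ^ 0 + (1 + 0 * J ω) * X ω ^ 1) ∂P := by
      refine integral_congr_ae ?_
      filter_upwards [hY] with ω hω
      rw [hω]
      ring
    rw [h, integral_add h0.1 h1.1, h0.2, h1.2, hX1, hX00]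
    ring
  · have h0 := key 0 (by norm_num) (d ^ 2 * p ^ 2) (d ^ 2 * (1 - 2 * p))
    have h1 := key 1 (by norm_num) (-2 * d * p) (2 * d)
    have h2 := key 2 (by norm_num) 1 0
    have h : ∫ ω, (Y ω - (m + d * p)) ^ 2 ∂P
        = ∫ ω, ((d ^ 2 * p ^ 2 + d ^ 2 * (1 - 2 * p) * J ω) * X ω ^ 0
          + (-2 * d * p + 2 * d * J ω) * X ω ^ 1 + (1 + 0 * J ω) * X ω ^ 2) ∂P := by
      refine integral_congr_ae ?_
      filter_upwards [hY] with ω hω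
      rw [hω]
      linear_combination d ^ 2 * hJsq ω
    rw [h, integral_add (h0.1.fun_add h1.1) h2.1, integral_add h0.1 h1.1,
      h0.2, h1.2, h2.2, hX1, hX00]
    ring
  · have h0 := key 0 (by norm_num) (-d ^ 3 * p ^ 3) (d ^ 3 * (1 - 3 * p + 3 * p ^ 2))
    have h1 := key 1 (by norm_num) (3 * d ^ 2 * p ^ 2) (3 * d ^ 2 * (1 - 2 * p))
    have h2 := key 2 (by norm_num) (-3 * d * p) (3 * d)
    have h3 := key 3 (by norm_num) 1 0
    have h : ∫ ω, (Y ω - (m + d * p)) ^ 3 ∂P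
        = ∫ ω, ((-d ^ 3 * p ^ 3 + d ^ 3 * (1 - 3 * p + 3 * p ^ 2) * J ω) * X ω ^ 0
          + (3 * d ^ 2 * p ^ 2 + 3 * d ^ 2 * (1 - 2 * p) * J ω) * X ω ^ 1
          + (-3 * d * p + 3 * d * J ω) * X ω ^ 2 + (1 + 0 * J ω) * X ω ^ 3) ∂P := by
      refine integral_congr_ae ?_
      filter_upwards [hY] with ω hω
      rw [hω]
      linear_combination (d ^ 3 * (J ω + 1 - 3 * p) + 3 * d ^ 2 * X ω) * hJsq ω
    rw [h, integral_add ((h0.1.fun_add h1.1).fun_add h2.1) h3.1,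
      integral_add (h0.1.fun_add h1.1) h2.1,
      integral_add h0.1 h1.1, h0.2, h1.2, h2.2, h3.2, hX1, hX00]
    ring

/-- Example 1, skewness: For the model `y_n = μ1 + e_n` if
`y_{n−1} ≤ r`, `y_n = μ2 + e_n` if `y_{n−1} > r`, with i.i.d. noise of mean 0,
variance `σ² > 0`, finite third moment and distribution function `G`, and `{y_n}`
the unique strictly stationary solution (so `P(y_{n−1} ≤ r) = δ0` and `e_n` is
independent of `y_{n−1}`), the skewness of `y_n` equals
`[E e₁³ + (μ1−μ2)³(δ0 − 3δ0² + 2δ0³)] / [σ² + (μ1−μ2)²δ0(1−δ0)]^{3/2}`. -/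
theorem tar_example_skewness
    {Ω : Type*} [MeasureSpace Ω] [IsProbabilityMeasure (ℙ : Measure Ω)]
    (e : ℤ → Ω → ℝ)
    (he : ∀ n, Measurable (e n))
    (hindep : iIndepFun e ℙ)
    (hident : ∀ n, Measure.map (e n) ℙ = Measure.map (e 0) ℙ)
    (σ2 : ℝ) (hσ2 : 0 < σ2)
    (hmean : ∫ ω, e 0 ω ∂ℙ = 0)
    (hint3 : Integrable (fun ω => |e 0 ω| ^ 3) ℙ)
    (hvar : ∫ ω, (e 0 ω) ^ 2 ∂ℙ = σ2)
    (G : ℝ → ℝ) (hG : ∀ x, G x = (ℙ {ω | e 0 ω ≤ x}).toReal)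
    (μ1 μ2 r : ℝ)
    (hnd : ℙ {ω | e 0 ω ≤ r - μ2 ∧ e 0 ω ≤ r - μ1}
      + ℙ {ω | r - μ2 < e 0 ω ∧ r - μ1 < e 0 ω} ≠ 0)
    (δ0 : ℝ) (hδ0 : δ0 = G (r - μ2) / (1 - G (r - μ1) + G (r - μ2)))
    (y : ℤ → Ω → ℝ)
    (hy_meas : ∀ n, Measurable (y n))
    (hmodel : ∀ n : ℤ, ∀ᵐ ω ∂ℙ,
      y n ω = if y (n - 1) ω ≤ r then μ1 + e n ω else μ2 + e n ω)
    (hpast : ∀ n : ℤ, IndepFun (e n) (y (n - 1)) ℙ)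
    (hlevel : ∀ n : ℤ, (ℙ {ω | y n ω ≤ r}).toReal = δ0) :
    ∀ n : ℤ,
      (∫ ω, (y n ω - ∫ x, y n x ∂ℙ) ^ 3 ∂ℙ)
          / (∫ ω, (y n ω - ∫ x, y n x ∂ℙ) ^ 2 ∂ℙ) ^ ((3 : ℝ) / 2)
        = ((∫ ω, (e 0 ω) ^ 3 ∂ℙ)
            + (μ1 - μ2) ^ 3 * (δ0 - 3 * δ0 ^ 2 + 2 * δ0 ^ 3))
          / (σ2 + (μ1 - μ2) ^ 2 * δ0 * (1 - δ0)) ^ ((3 : ℝ) / 2) := by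
  intro n
  have hid : IdentDistrib (e n) (e 0) ℙ ℙ :=
    ⟨(he n).aemeasurable, (he 0).aemeasurable, hident n⟩
  have hX0 : ∫ ω, e n ω ∂ℙ = 0 := hid.integral_eq.trans hmean
  have hmom : ∀ k : ℕ, ∫ ω, e n ω ^ k ∂ℙ = ∫ ω, e 0 ω ^ k ∂ℙ := fun k =>
    (hid.comp (measurable_id.pow_const k)).integral_eq
  have hL0 : MemLp (e 0) 3 ℙ := by
    refine (integrable_norm_rpow_iff (he 0).aestronglyMeasurable (by norm_num) (by norm_num)).1 ?_
    refine hint3.congr (Eventually.of_forall fun ω => ?_)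
    exact (Real.rpow_natCast |e 0 ω| 3).symm
  have hL : MemLp (e n) 3 ℙ := hid.memLp_iff.2 hL0
  have hset : MeasurableSet {ω | y (n - 1) ω ≤ r} := hy_meas (n - 1) measurableSet_Iic
  set J : Ω → ℝ := {ω | y (n - 1) ω ≤ r}.indicator 1 with hJdef
  have hJint : Integrable J ℙ := (integrable_const (1 : ℝ)).indicator hset
  have hJp : ∫ ω, J ω ∂ℙ = δ0 := by
    rw [hJdef, integral_indicator_one hset, ← hlevel (n - 1)]
    rfl
  have hJsq : ∀ ω, J ω ^ 2 = J ω := fun ω => by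
    by_cases h : y (n - 1) ω ≤ r <;> simp [hJdef, h]
  have hXJ : IndepFun (e n) J ℙ :=
    (hpast n).comp (φ := id) (ψ := (Set.Iic r).indicator 1) measurable_id
      (measurable_one.indicator measurableSet_Iic)
  have hY : ∀ᵐ ω ∂ℙ, y n ω = μ2 + (μ1 - μ2) * J ω + e n ω := by
    filter_upwards [hmodel n] with ω hω
    rw [hω]
    by_cases h : y (n - 1) ω ≤ r <;> simp [hJdef, h]
  obtain ⟨h1, h2, h3⟩ :=
    central_moments_add_indicator_add hXJ hJint hJsq hL hX0 μ2 (μ1 - μ2) hY hJp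
  rw [h1, h2, h3, hmom 2, hmom 3, hvar]
end

section
/- Let {e_n} be i.i.d. with mean 0, finite variance σ² > 0, finite fourth moment, and distribution function G, and let {y_n} be the unique strictly stationary solution of y_n = μ1 + e_n if y_{n−1} ≤ r and y_n = μ2 + e_n if y_{n−1} > r, with δ0 = G(r−μ2)/[1 − G(r−μ1) + G(r−μ2)]. Then the kurtosis of y_n equals [E e_1⁴ + 6σ²(μ1−μ2)²·δ0·(1−δ0) + (μ1−μ2)⁴·(δ0 − 4δ0² + 6δ0³ − 3δ0⁴)] / [σ² + (μ1−μ2)²·δ0·(1−δ0)]², i.e. E[(y_n − E y_n)⁴]/Var(y_n)² equals this expression. -/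
open MeasureTheory ProbabilityTheory Filter Finset

/-- A variable equal to `f X` or `g X` according to an independent event has the mixed mean. -/
theorem integral_ite_of_indepFun {Ω : Type*} {m : MeasurableSpace Ω} {P : Measure Ω}
    [IsProbabilityMeasure P] {X Z : Ω → ℝ} (hZ : Measurable Z)
    (hXZ : IndepFun X Z P) {f g : ℝ → ℝ} (hf : Measurable f) (hg : Measurable g)
    (hfX : Integrable (fun ω => f (X ω)) P) (hgX : Integrable (fun ω => g (X ω)) P) (r : ℝ) :
    ∫ ω, (if Z ω ≤ r then f (X ω) else g (X ω)) ∂P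
      = (P {ω | Z ω ≤ r}).toReal * ∫ ω, f (X ω) ∂P
        + (1 - (P {ω | Z ω ≤ r}).toReal) * ∫ ω, g (X ω) ∂P := by
  set b : ℝ → ℝ := (Set.Iic r).indicator 1 with hb
  have hbm : Measurable b := measurable_one.indicator measurableSet_Iic
  have hmix : ∀ ω, (if Z ω ≤ r then f (X ω) else g (X ω))
      = f (X ω) * b (Z ω) + g (X ω) * (1 - b (Z ω)) := by
    intro ω
    by_cases h : Z ω ≤ r <;> simp [hb, h]
  have hA : MeasurableSet {ω | Z ω ≤ r} := hZ measurableSet_Iic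
  have hbZ : (fun ω => b (Z ω)) = {ω | Z ω ≤ r}.indicator 1 := by
    funext ω
    by_cases h : Z ω ≤ r <;> simp [hb, Set.indicator, h]
  have hbint : Integrable (fun ω => b (Z ω)) P := by
    rw [hbZ]
    exact (integrable_const (1 : ℝ)).indicator hA
  have hbmean : ∫ ω, b (Z ω) ∂P = (P {ω | Z ω ≤ r}).toReal := by
    rw [hbZ, integral_indicator_one hA, Measure.real]
  have hcint : Integrable (fun ω => 1 - b (Z ω)) P := (integrable_const _).sub hbint
  have hfb : IndepFun (fun ω => f (X ω)) (fun ω => b (Z ω)) P := hXZ.comp hf hbm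
  have hgb : IndepFun (fun ω => g (X ω)) (fun ω => 1 - b (Z ω)) P :=
    hXZ.comp hg (hbm.const_sub 1)
  have hfbint : Integrable (fun ω => f (X ω) * b (Z ω)) P := hfb.integrable_mul hfX hbint
  have hgbint : Integrable (fun ω => g (X ω) * (1 - b (Z ω))) P := hgb.integrable_mul hgX hcint
  simp_rw [hmix]
  rw [integral_add hfbint hgbint,
    hfb.integral_fun_mul_eq_mul_integral hfX.1 hbint.1,
    hgb.integral_fun_mul_eq_mul_integral hgX.1 hcint.1,
    integral_sub (integrable_const _) hbint, hbmean]
  simp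
  ring

theorem integrable_pow_of_integrable_pow_four {Ω : Type*} {m : MeasurableSpace Ω}
    {P : Measure Ω} [IsFiniteMeasure P] {X : Ω → ℝ} (hX : Measurable X)
    (h4 : Integrable (fun ω => X ω ^ 4) P) {k : ℕ} (hk : k ≤ 4) :
    Integrable (fun ω => X ω ^ k) P := by
  refine ((integrable_const (1 : ℝ)).add h4).mono' (hX.pow_const k).aestronglyMeasurable
    (ae_of_all _ fun ω => ?_)
  have habs : |X ω| ^ 4 = X ω ^ 4 := Even.pow_abs (by decide) _
  simp only [Real.norm_eq_abs, abs_pow, Pi.add_apply, ← habs]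
  rcases le_total |X ω| 1 with h | h
  · linarith [pow_le_one₀ (n := k) (abs_nonneg (X ω)) h, pow_nonneg (abs_nonneg (X ω)) 4]
  · linarith [pow_le_pow_right₀ h hk]

/-- Moments of a shifted variable, by the binomial theorem. -/
theorem integrable_and_integral_add_pow {Ω : Type*} {m : MeasurableSpace Ω}
    {P : Measure Ω} {X : Ω → ℝ} {k : ℕ} (c : ℝ)
    (hX : ∀ j ≤ k, Integrable (fun ω => X ω ^ j) P) :
    Integrable (fun ω => (X ω + c) ^ k) P ∧
      ∫ ω, (X ω + c) ^ k ∂P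
        = ∑ j ∈ Finset.range (k + 1), (∫ ω, X ω ^ j ∂P) * c ^ (k - j) * (k.choose j : ℝ) := by
  have hterm : ∀ j ∈ Finset.range (k + 1),
      Integrable (fun ω => X ω ^ j * c ^ (k - j) * (k.choose j : ℝ)) P := fun j hj =>
    ((hX j (Nat.lt_succ_iff.mp (Finset.mem_range.mp hj))).mul_const _).mul_const _
  simp_rw [add_pow]
  refine ⟨integrable_finsetSum _ hterm, ?_⟩
  rw [integral_finsetSum _ hterm]
  simp_rw [integral_mul_const]

/-- Example 1, kurtosis: For the model `y_n = μ1 + e_n` if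
`y_{n−1} ≤ r`, `y_n = μ2 + e_n` if `y_{n−1} > r`, with i.i.d. noise of mean 0,
variance `σ² > 0`, finite fourth moment and distribution function `G`, and `{y_n}`
the unique strictly stationary solution (so `P(y_{n−1} ≤ r) = δ0` and `e_n` is
independent of `y_{n−1}`), the kurtosis of `y_n` equals
`[E e₁⁴ + 6σ²(μ1−μ2)²δ0(1−δ0) + (μ1−μ2)⁴(δ0 − 4δ0² + 6δ0³ − 3δ0⁴)]
  / [σ² + (μ1−μ2)²δ0(1−δ0)]²`. -/
theorem tar_example_kurtosis
    {Ω : Type*} [MeasureSpace Ω] [IsProbabilityMeasure (ℙ : Measure Ω)]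
    (e : ℤ → Ω → ℝ)
    (he : ∀ n, Measurable (e n))
    (hindep : iIndepFun e ℙ)
    (hident : ∀ n, Measure.map (e n) ℙ = Measure.map (e 0) ℙ)
    (σ2 : ℝ) (hσ2 : 0 < σ2)
    (hmean : ∫ ω, e 0 ω ∂ℙ = 0)
    (hint4 : Integrable (fun ω => (e 0 ω) ^ 4) ℙ)
    (hvar : ∫ ω, (e 0 ω) ^ 2 ∂ℙ = σ2)
    (G : ℝ → ℝ) (hG : ∀ x, G x = (ℙ {ω | e 0 ω ≤ x}).toReal)
    (μ1 μ2 r : ℝ)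
    (hnd : ℙ {ω | e 0 ω ≤ r - μ2 ∧ e 0 ω ≤ r - μ1}
      + ℙ {ω | r - μ2 < e 0 ω ∧ r - μ1 < e 0 ω} ≠ 0)
    (δ0 : ℝ) (hδ0 : δ0 = G (r - μ2) / (1 - G (r - μ1) + G (r - μ2)))
    (y : ℤ → Ω → ℝ)
    (hy_meas : ∀ n, Measurable (y n))
    (hmodel : ∀ n : ℤ, ∀ᵐ ω ∂ℙ,
      y n ω = if y (n - 1) ω ≤ r then μ1 + e n ω else μ2 + e n ω)
    (hpast : ∀ n : ℤ, IndepFun (e n) (y (n - 1)) ℙ)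
    (hlevel : ∀ n : ℤ, (ℙ {ω | y n ω ≤ r}).toReal = δ0) :
    ∀ n : ℤ,
      (∫ ω, (y n ω - ∫ x, y n x ∂ℙ) ^ 4 ∂ℙ)
          / (∫ ω, (y n ω - ∫ x, y n x ∂ℙ) ^ 2 ∂ℙ) ^ 2
        = ((∫ ω, (e 0 ω) ^ 4 ∂ℙ)
            + 6 * σ2 * (μ1 - μ2) ^ 2 * δ0 * (1 - δ0)
            + (μ1 - μ2) ^ 4 * (δ0 - 4 * δ0 ^ 2 + 6 * δ0 ^ 3 - 3 * δ0 ^ 4))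
          / (σ2 + (μ1 - μ2) ^ 2 * δ0 * (1 - δ0)) ^ 2 := by
  intro n
  have hid : IdentDistrib (e n) (e 0) ℙ ℙ := ⟨(he n).aemeasurable, (he 0).aemeasurable, hident n⟩
  have hmom : ∀ k : ℕ, ∫ ω, e n ω ^ k ∂ℙ = ∫ ω, e 0 ω ^ k ∂ℙ := fun k =>
    (hid.comp (measurable_id.pow_const k)).integral_eq
  have hpow : ∀ k ≤ 4, Integrable (fun ω => e n ω ^ k) ℙ := fun k hk =>
    integrable_pow_of_integrable_pow_four (he n)
      ((hid.comp (measurable_id.pow_const 4)).integrable_iff.mpr hint4) hk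
  have hshift : ∀ k ≤ 4, ∀ c : ℝ, Integrable (fun ω => (e n ω + c) ^ k) ℙ ∧
      ∫ ω, (e n ω + c) ^ k ∂ℙ = ∑ j ∈ Finset.range (k + 1),
        (∫ ω, e n ω ^ j ∂ℙ) * c ^ (k - j) * (k.choose j : ℝ) := fun k hk c =>
    integrable_and_integral_add_pow c fun j hj => hpow j (hj.trans hk)
  have hy : ∀ k ≤ 4, ∀ a : ℝ, ∫ ω, (y n ω - a) ^ k ∂ℙ
      = δ0 * ∫ ω, (e n ω + (μ1 - a)) ^ k ∂ℙ
        + (1 - δ0) * ∫ ω, (e n ω + (μ2 - a)) ^ k ∂ℙ := by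
    intro k hk a
    rw [← hlevel (n - 1), ← integral_ite_of_indepFun (hy_meas (n - 1)) (hpast n)
      (f := fun x => (x + (μ1 - a)) ^ k) (g := fun x => (x + (μ2 - a)) ^ k)
      (by fun_prop) (by fun_prop) (hshift k hk _).1 (hshift k hk _).1 r]
    refine integral_congr_ae ?_
    filter_upwards [hmodel n] with ω hω
    rw [hω]
    split_ifs <;> ring
  have hm1 : ∫ ω, e n ω ∂ℙ = 0 := by simpa [hmean] using hmom 1
  have hmeany : ∫ ω, y n ω ∂ℙ = δ0 * μ1 + (1 - δ0) * μ2 := by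
    have h := hy 1 (by norm_num) 0
    rw [(hshift 1 (by norm_num) _).2, (hshift 1 (by norm_num) _).2] at h
    simpa [Finset.sum_range_succ, hm1] using h
  have hsecond : ∫ ω, (y n ω - ∫ x, y n x ∂ℙ) ^ 2 ∂ℙ
      = σ2 + (μ1 - μ2) ^ 2 * δ0 * (1 - δ0) := by
    rw [hy 2 (by norm_num), (hshift 2 (by norm_num) _).2, (hshift 2 (by norm_num) _).2, hmeany]
    simp [Finset.sum_range_succ, hm1, hmom 2, hvar]
    ring
  have hfourth : ∫ ω, (y n ω - ∫ x, y n x ∂ℙ) ^ 4 ∂ℙ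
      = (∫ ω, (e 0 ω) ^ 4 ∂ℙ) + 6 * σ2 * (μ1 - μ2) ^ 2 * δ0 * (1 - δ0)
        + (μ1 - μ2) ^ 4 * (δ0 - 4 * δ0 ^ 2 + 6 * δ0 ^ 3 - 3 * δ0 ^ 4) := by
    rw [hy 4 le_rfl, (hshift 4 le_rfl _).2, (hshift 4 le_rfl _).2, hmeany]
    simp [Finset.sum_range_succ, hm1, hmom 2, hmom 4, hvar, Nat.choose]
    ring
  rw [hsecond, hfourth]
end
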